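/- (Proposition 4.1) Fix λ > 0 and s > 0, and set L(s) = U(s) + (λ s^{2α₁}/C₁²) E²_{α₁−α₂, 2α₁+1}(−C₂ s^{α₁−α₂}/C₁). Then the covariance of the mixed fractional Poisson process satisfies lim_{t→∞} t^{1−α₂} (Cov_N(s,t) − λ L(s)) = −λ² K(s); that is, Cov_N(s,t) = λL(s) − λ² K(s) t^{α₂−1} + o(t^{α₂−1}) as t → ∞. -/

import Mathlib

open Real MeasureTheory Filter Topology

/-- Two-parameter Mittag-Leffler function `E_{a,b}(x)`. -/
noncomputable def ML (a b x : ℝ) : ℝ :=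
  ∑' k : ℕ, x ^ k / Real.Gamma ((k : ℝ) * a + b)

/-- Second-order (three-parameter, `γ = 2`) Mittag-Leffler function `E²_{a,b}(x)`. -/
noncomputable def ML2 (a b x : ℝ) : ℝ :=
  ∑' k : ℕ, ((k : ℝ) + 1) * x ^ k / Real.Gamma ((k : ℝ) * a + b)

/-- Renewal function `U(t)` of the inverse mixed stable subordinator. -/
noncomputable def Ufun (a1 a2 C1 C2 t : ℝ) : ℝ :=
  t ^ a1 / C1 * ML (a1 - a2) (a1 + 1) (-C2 * t ^ (a1 - a2) / C1)

/-- Renewal density `u(t)` of the inverse mixed stable subordinator. -/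
noncomputable def ufun (a1 a2 C1 C2 t : ℝ) : ℝ :=
  t ^ (a1 - 1) / C1 * ML (a1 - a2) a1 (-C2 * t ^ (a1 - a2) / C1)

/-- Covariance function of the inverse mixed stable subordinator. -/
noncomputable def CovY (a1 a2 C1 C2 s t : ℝ) : ℝ :=
  (∫ τ in (0:ℝ)..(min s t),
      (Ufun a1 a2 C1 C2 (s - τ) + Ufun a1 a2 C1 C2 (t - τ)) * ufun a1 a2 C1 C2 τ)
    - Ufun a1 a2 C1 C2 s * Ufun a1 a2 C1 C2 t

/-- Variance function of the inverse mixed stable subordinator. -/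
noncomputable def VarY (a1 a2 C1 C2 t : ℝ) : ℝ := CovY a1 a2 C1 C2 t t

/-- The integral `I(s,t) = ∫₀^s U(t-τ) u(τ) dτ`. -/
noncomputable def Ifun (a1 a2 C1 C2 s t : ℝ) : ℝ :=
  ∫ τ in (0:ℝ)..s, Ufun a1 a2 C1 C2 (t - τ) * ufun a1 a2 C1 C2 τ

/-- The constant `K(s)`. -/
noncomputable def Kfun (a1 a2 C1 C2 s : ℝ) : ℝ :=
  s ^ (a1 + 1) / (C1 * C2 * Real.Gamma a2) *
    ∑' k : ℕ, ((k : ℝ) * (a1 - a2) + a1) * (-C2 * s ^ (a1 - a2) / C1) ^ k /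
      Real.Gamma ((k : ℝ) * (a1 - a2) + a1 + 2)

/-- Covariance function of the mixed fractional Poisson process. -/
noncomputable def CovN (a1 a2 C1 C2 lam s t : ℝ) : ℝ :=
  lam * Ufun a1 a2 C1 C2 (min s t) + lam ^ 2 * CovY a1 a2 C1 C2 s t

/-- Variance function of the mixed fractional Poisson process. -/
noncomputable def VarN (a1 a2 C1 C2 lam t : ℝ) : ℝ :=
  lam * Ufun a1 a2 C1 C2 t + lam ^ 2 * VarY a1 a2 C1 C2 t

/-- Correlation function of the inverse mixed stable subordinator. -/
noncomputable def CorrY (a1 a2 C1 C2 s t : ℝ) : ℝ :=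
  CovY a1 a2 C1 C2 s t /
    (Real.sqrt (VarY a1 a2 C1 C2 s) * Real.sqrt (VarY a1 a2 C1 C2 t))

/-- Correlation function of the mixed fractional Poisson process. -/
noncomputable def CorrN (a1 a2 C1 C2 lam s t : ℝ) : ℝ :=
  CovN a1 a2 C1 C2 lam s t /
    (Real.sqrt (VarN a1 a2 C1 C2 lam s) * Real.sqrt (VarN a1 a2 C1 C2 lam t))

/-- Covariance function of the mixed fractional Poissonian noise. -/
noncomputable def CovZ (a1 a2 C1 C2 lam δ s t : ℝ) : ℝ :=
  CovN a1 a2 C1 C2 lam (s + δ) (t + δ) + CovN a1 a2 C1 C2 lam s t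
    - CovN a1 a2 C1 C2 lam (s + δ) t - CovN a1 a2 C1 C2 lam s (t + δ)

/-- Variance function of the mixed fractional Poissonian noise. -/
noncomputable def VarZ (a1 a2 C1 C2 lam δ t : ℝ) : ℝ := CovZ a1 a2 C1 C2 lam δ t t

/-- Correlation function of the mixed fractional Poissonian noise. -/
noncomputable def CorrZ (a1 a2 C1 C2 lam δ s t : ℝ) : ℝ :=
  CovZ a1 a2 C1 C2 lam δ s t /
    (Real.sqrt (VarZ a1 a2 C1 C2 lam δ s) * Real.sqrt (VarZ a1 a2 C1 C2 lam δ t))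

/-- Incomplete Beta function `B(a, b; x)`. -/
noncomputable def Binc (a b x : ℝ) : ℝ :=
  ∫ y in (0:ℝ)..x, y ^ (a - 1) * (1 - y) ^ (b - 1)

lemma rpow_mul_exp_le_Gamma {M y : ℝ} (hM : 0 < M) (hy : 0 < y) :
    M ^ y * (exp (-(M + 1)) / (M + 1)) ≤ Gamma y := by
  have hint := Real.GammaIntegral_convergent hy
  have hsub : Set.Ioc M (M + 1) ⊆ Set.Ioi 0 := fun x hx => hM.trans hx.1
  calc M ^ y * (exp (-(M + 1)) / (M + 1))
      = ∫ _ in Set.Ioc M (M + 1), M ^ y * (exp (-(M + 1)) / (M + 1)) := by simp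
    _ ≤ ∫ x in Set.Ioc M (M + 1), exp (-x) * x ^ (y - 1) := by
        refine setIntegral_mono_on continuous_const.integrableOn_Ioc (hint.mono_set hsub)
          measurableSet_Ioc ?_
        intro x hx
        have hx0 : 0 < x := hM.trans hx.1
        rw [rpow_sub_one hx0.ne', ← mul_div_assoc, ← mul_div_assoc, mul_comm]
        gcongr
        · exact hx.2
        · exact hx.1.le
        · exact hx.2
    _ ≤ ∫ x in Set.Ioi 0, exp (-x) * x ^ (y - 1) := by
        refine setIntegral_mono_set hint ?_ hsub.eventuallyLE
        filter_upwards [ae_restrict_mem measurableSet_Ioi] with x hx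
        exact mul_nonneg (exp_pos _).le (rpow_nonneg (le_of_lt hx) _)
    _ = Gamma y := (Real.Gamma_eq_integral hy).symm

lemma summable_succ_mul_pow_div_Gamma {a b : ℝ} (ha : 0 < a) (hb : 0 < b) (x : ℝ) :
    Summable fun k : ℕ => ((k : ℝ) + 1) * |x| ^ k / Gamma (k * a + b) := by
  set M : ℝ := (2 * (|x| + 1)) ^ a⁻¹ with hMdef
  have hM : 0 < M := by positivity
  have hMa : M ^ a = 2 * (|x| + 1) := by
    rw [hMdef, rpow_inv_rpow (by positivity) ha.ne']
  set D : ℝ := exp (-(M + 1)) / (M + 1) with hD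
  have hDpos : 0 < D := by positivity
  have hgeom : Summable fun k : ℕ => ((k : ℝ) + 1) * (1 / 2 : ℝ) ^ k := by
    have h1 := summable_pow_mul_geometric_of_norm_lt_one (R := ℝ) 1 (r := 1 / 2) (by norm_num)
    have h2 := summable_geometric_of_lt_one (r := (1 / 2 : ℝ)) (by norm_num) (by norm_num)
    simpa [add_mul] using h1.add h2
  refine Summable.of_nonneg_of_le (fun k => ?_) (fun k => ?_) (hgeom.mul_left (1 / (M ^ b * D)))
  · have := Gamma_pos_of_pos (s := k * a + b) (by positivity)
    positivity
  · have h := rpow_mul_exp_le_Gamma (M := M) (y := k * a + b) hM (by positivity)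
    rw [rpow_add hM, mul_comm (k : ℝ) a, rpow_mul hM.le, hMa, rpow_natCast, ← hD] at h
    rw [mul_comm (k : ℝ) a]
    calc ((k : ℝ) + 1) * |x| ^ k / Gamma (a * k + b)
        ≤ ((k : ℝ) + 1) * |x| ^ k / ((2 * (|x| + 1)) ^ k * M ^ b * D) := by gcongr
      _ ≤ ((k : ℝ) + 1) * (|x| + 1) ^ k / ((2 * (|x| + 1)) ^ k * M ^ b * D) := by
          gcongr; linarith
      _ = _ := by
          have : (|x| + 1) ^ k ≠ 0 := by positivity
          rw [mul_pow, one_div_pow]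
          field_simp

lemma summable_pow_div_Gamma {a b : ℝ} (ha : 0 < a) (hb : 0 < b) (x : ℝ) :
    Summable fun k : ℕ => |x| ^ k / Gamma (k * a + b) := by
  refine Summable.of_nonneg_of_le (fun k => ?_) (fun k => ?_)
    (summable_succ_mul_pow_div_Gamma ha hb x)
  all_goals have := Gamma_pos_of_pos (s := k * a + b) (by positivity)
  · positivity
  · gcongr
    exact le_mul_of_one_le_left (by positivity) (by linarith [k.cast_nonneg (α := ℝ)])

/-- The Mittag-Leffler series as an entire function. -/
lemma differentiable_tsum_pow_div_Gamma {a b : ℝ} (ha : 0 < a) (hb : 0 < b) :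
    Differentiable ℂ fun z : ℂ => ∑' k : ℕ, z ^ k / (Gamma (k * a + b) : ℂ) := by
  intro z
  have hz : z ∈ Metric.ball (0 : ℂ) (‖z‖ + 1) := by simp
  refine (Complex.differentiableOn_tsum_of_summable_norm
    (summable_pow_div_Gamma ha hb (‖z‖ + 1)) (fun k => ?_) Metric.isOpen_ball
    (fun k w hw => ?_)).differentiableAt (Metric.isOpen_ball.mem_nhds hz)
  · fun_prop
  · have := Gamma_pos_of_pos (s := k * a + b) (by positivity)
    rw [norm_div, norm_pow, Complex.norm_real, norm_of_nonneg this.le]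
    rw [mem_ball_zero_iff] at hw
    gcongr
    exact hw.le.trans (le_abs_self _)

lemma ofReal_ML (a b x : ℝ) :
    (ML a b x : ℂ) = ∑' k : ℕ, (x : ℂ) ^ k / (Gamma (k * a + b) : ℂ) := by
  rw [ML, Complex.ofReal_tsum]
  push_cast
  rfl

lemma continuous_ML {a b : ℝ} (ha : 0 < a) (hb : 0 < b) : Continuous (ML a b) := by
  have h : ML a b = fun x : ℝ => (∑' k : ℕ, (x : ℂ) ^ k / (Gamma (k * a + b) : ℂ)).re := by
    ext x
    rw [← ofReal_ML, Complex.ofReal_re]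
  rw [h]
  exact Complex.continuous_re.comp
    ((differentiable_tsum_pow_div_Gamma ha hb).continuous.comp Complex.continuous_ofReal)

lemma integrableOn_rpow_mul_exp_neg_mul {s r : ℝ} (hs : 0 < s) (hr : 0 < r) :
    IntegrableOn (fun t : ℝ => t ^ (s - 1) * exp (-(r * t))) (Set.Ioi 0) := by
  simpa [neg_mul] using
    integrableOn_rpow_mul_exp_neg_mul_rpow (p := 1) (s := s - 1) (b := r) (by linarith) one_pos hr

lemma aestronglyMeasurable_rpow_mul_cexp (s : ℝ) (z : ℂ) :
    AEStronglyMeasurable (fun t : ℝ => ((t ^ (s - 1) : ℝ) : ℂ) * Complex.exp (-(z * t)))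
      (volume.restrict (Set.Ioi 0)) := by
  have : Measurable (fun t : ℝ => ((t ^ (s - 1) : ℝ) : ℂ) * Complex.exp (-(z * t))) := by
    fun_prop
  exact this.aestronglyMeasurable

lemma norm_rpow_mul_cexp {s t : ℝ} (ht : 0 < t) (z : ℂ) :
    ‖((t ^ (s - 1) : ℝ) : ℂ) * Complex.exp (-(z * t))‖ = t ^ (s - 1) * exp (-(z.re * t)) := by
  rw [norm_mul, Complex.norm_real, norm_of_nonneg (by positivity), Complex.norm_exp]
  simp

lemma integrableOn_rpow_mul_cexp {s : ℝ} {z : ℂ} (hs : 0 < s) (hz : 0 < z.re) :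
    IntegrableOn (fun t : ℝ => ((t ^ (s - 1) : ℝ) : ℂ) * Complex.exp (-(z * t)))
      (Set.Ioi 0) := by
  refine (integrableOn_rpow_mul_exp_neg_mul hs hz).mono'
    (aestronglyMeasurable_rpow_mul_cexp s z) ?_
  filter_upwards [ae_restrict_mem measurableSet_Ioi] with t ht
  exact (norm_rpow_mul_cexp ht z).le

lemma differentiableAt_laplace_rpow {s : ℝ} {z : ℂ} (hs : 0 < s) (hz : 0 < z.re) :
    DifferentiableAt ℂ
      (fun z : ℂ => ∫ t in Set.Ioi (0 : ℝ), ((t ^ (s - 1) : ℝ) : ℂ) * Complex.exp (-(z * t)))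
      z := by
  have hmem : {w : ℂ | z.re / 2 < w.re} ∈ 𝓝 z :=
    (isOpen_lt continuous_const Complex.continuous_re).mem_nhds (by simpa using hz)
  refine (hasDerivAt_integral_of_dominated_loc_of_deriv_le
    (F' := fun w t => -(((t ^ (s + 1 - 1) : ℝ) : ℂ) * Complex.exp (-(w * t))))
    (bound := fun t => t ^ (s + 1 - 1) * exp (-(z.re / 2 * t))) hmem
    (Eventually.of_forall fun w => aestronglyMeasurable_rpow_mul_cexp s w)
    (integrableOn_rpow_mul_cexp hs hz) (aestronglyMeasurable_rpow_mul_cexp (s + 1) z).neg ?_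
    (integrableOn_rpow_mul_exp_neg_mul (by linarith) (by linarith)) ?_).2.differentiableAt
  · filter_upwards [ae_restrict_mem measurableSet_Ioi] with t ht w hw
    rw [Set.mem_Ioi] at ht
    change z.re / 2 < w.re at hw
    rw [norm_neg, norm_rpow_mul_cexp ht]
    gcongr
  · filter_upwards [ae_restrict_mem measurableSet_Ioi] with t ht w hw
    rw [Set.mem_Ioi] at ht
    have h1 : HasDerivAt (fun w : ℂ => -(w * t)) (-(1 * (t : ℂ))) w :=
      ((hasDerivAt_id w).mul_const (t : ℂ)).neg
    convert! h1.cexp.const_mul ((t ^ (s - 1) : ℝ) : ℂ) using 1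
    have : (t ^ (s + 1 - 1) : ℝ) = t ^ (s - 1) * t := by
      rw [← rpow_add_one ht.ne']; ring_nf
    rw [this]
    push_cast
    ring

/-- The Laplace transform of a power function, at a complex argument. -/
lemma laplace_rpow {s : ℝ} {z : ℂ} (hs : 0 < s) (hz : 0 < z.re) :
    ∫ t in Set.Ioi (0 : ℝ), ((t ^ (s - 1) : ℝ) : ℂ) * Complex.exp (-(z * t))
      = Gamma s * z ^ (-s : ℂ) := by
  have hopen : IsOpen {w : ℂ | 0 < w.re} := isOpen_lt continuous_const Complex.continuous_re
  have hconv : IsPreconnected {w : ℂ | 0 < w.re} := (convex_halfSpace_re_gt 0).isPreconnected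
  have hL : AnalyticOnNhd ℂ (fun z : ℂ => ∫ t in Set.Ioi (0 : ℝ),
      ((t ^ (s - 1) : ℝ) : ℂ) * Complex.exp (-(z * t))) {w : ℂ | 0 < w.re} :=
    DifferentiableOn.analyticOnNhd
      (fun w hw => (differentiableAt_laplace_rpow hs hw).differentiableWithinAt) hopen
  have hR : AnalyticOnNhd ℂ (fun z : ℂ => (Gamma s : ℂ) * z ^ (-s : ℂ)) {w : ℂ | 0 < w.re} := by
    refine DifferentiableOn.analyticOnNhd (fun w hw => ?_) hopen
    refine DifferentiableAt.differentiableWithinAt (DifferentiableAt.const_mul ?_ _)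
    exact differentiableAt_id.cpow_const (Or.inl hw)
  refine hL.eqOn_of_preconnected_of_frequently_eq hR hconv (z₀ := 1) (by simp) ?_ hz
  have hreal : ∀ r : ℝ, 0 < r → (∫ t in Set.Ioi (0 : ℝ),
      ((t ^ (s - 1) : ℝ) : ℂ) * Complex.exp (-((r : ℂ) * t)))
        = (Gamma s : ℂ) * (r : ℂ) ^ (-s : ℂ) := by
    intro r hr
    have h := integral_rpow_mul_exp_neg_mul_Ioi hs hr
    rw [one_div, inv_rpow hr.le, ← rpow_neg hr.le] at h
    rw [← Complex.ofReal_neg, ← Complex.ofReal_cpow hr.le, ← Complex.ofReal_mul,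
      mul_comm (Gamma s), ← h, ← integral_complex_ofReal]
    push_cast
    rfl
  have htend : Tendsto (fun n : ℕ => ((1 + 1 / ((n : ℝ) + 1) : ℝ) : ℂ)) atTop (𝓝[≠] 1) := by
    refine tendsto_nhdsWithin_iff.2 ⟨?_, Eventually.of_forall fun n => ?_⟩
    · have h := tendsto_one_div_add_atTop_nhds_zero_nat (𝕜 := ℝ)
      have h2 := (Complex.continuous_ofReal.tendsto _).comp (h.const_add 1)
      simpa [Function.comp_def] using h2
    · have : (0 : ℝ) < 1 / ((n : ℝ) + 1) := by positivity
      rw [Set.mem_compl_singleton_iff, Ne, Complex.ofReal_eq_one]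
      linarith
  exact htend.frequently (Frequently.of_forall fun n => hreal _ (by positivity))

/-- The vertical line `Re w = 1`, parametrised with speed `2π`. -/
noncomputable def vline (ξ : ℝ) : ℂ := 1 + 2 * π * ξ * Complex.I

lemma vline_re (ξ : ℝ) : (vline ξ).re = 1 := by simp [vline]

lemma vline_im (ξ : ℝ) : (vline ξ).im = 2 * π * ξ := by simp [vline]

lemma vline_ne_zero (ξ : ℝ) : vline ξ ≠ 0 :=
  Complex.ne_zero_of_re_pos (by simp [vline_re])

lemma vline_mem_slitPlane (ξ : ℝ) : vline ξ ∈ Complex.slitPlane :=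
  Or.inl (by simp [vline_re])

lemma continuous_vline : Continuous vline := by unfold vline; fun_prop

lemma one_le_norm_vline (ξ : ℝ) : 1 ≤ ‖vline ξ‖ := by
  simpa [vline_re] using Complex.re_le_norm (vline ξ)

lemma norm_vline_cpow (ξ s : ℝ) : ‖vline ξ ^ (s : ℂ)‖ = ‖vline ξ‖ ^ s :=
  Complex.norm_cpow_real _ _

lemma continuous_vline_cpow (s : ℂ) : Continuous fun ξ => vline ξ ^ s :=
  continuous_iff_continuousAt.2 fun ξ =>
    continuous_vline.continuousAt.cpow continuousAt_const (vline_mem_slitPlane ξ)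

lemma integrable_vline_cpow {s : ℝ} (hs : 1 < s) :
    Integrable fun ξ : ℝ => vline ξ ^ (-s : ℂ) := by
  have h := (integrable_rpow_neg_one_add_norm_sq (E := ℝ) (μ := volume) (r := s) (by simpa))
  refine h.mono' (continuous_vline_cpow _).aestronglyMeasurable (Eventually.of_forall fun ξ => ?_)
  rw [← Complex.ofReal_neg, norm_vline_cpow, norm_eq_abs, sq_abs, Complex.norm_def,
    Complex.normSq_apply, vline_re, vline_im, sqrt_eq_rpow, 
    ← rpow_mul (add_nonneg (mul_self_nonneg _) (mul_self_nonneg _))]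
  have hpi : 1 ≤ 2 * π := by linarith [pi_gt_three]
  have : 1 + ξ ^ 2 ≤ 1 * 1 + 2 * π * ξ * (2 * π * ξ) := by
    nlinarith [mul_le_mul_of_nonneg_right (one_le_pow₀ hpi (n := 2)) (sq_nonneg ξ)]
  calc (1 * 1 + 2 * π * ξ * (2 * π * ξ)) ^ (1 / 2 * -s)
      = (1 * 1 + 2 * π * ξ * (2 * π * ξ)) ^ (-s / 2) := by ring_nf
    _ ≤ (1 + ξ ^ 2) ^ (-s / 2) :=
      rpow_le_rpow_of_nonpos (by positivity) this (by linarith)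

/-- Bromwich's integral for the reciprocal Gamma function. -/
lemma integral_exp_mul_vline_cpow {s : ℝ} (hs : 1 < s) :
    ∫ ξ : ℝ, Complex.exp (vline ξ) * vline ξ ^ (-s : ℂ) = 1 / Gamma s := by
  have hs0 : 0 < s := by linarith
  have hG := (Gamma_pos_of_pos hs0).ne'
  set f : ℝ → ℂ := (Set.Ioi 0).indicator
    (fun t : ℝ => ((t ^ (s - 1) : ℝ) : ℂ) * Complex.exp (-((1 : ℂ) * t))) with hf
  have hfint : Integrable f :=
    (integrable_indicator_iff measurableSet_Ioi).2
      (integrableOn_rpow_mul_cexp hs0 (by simp))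
  have hfourier : FourierTransform.fourier f = fun ξ => (Gamma s : ℂ) * vline ξ ^ (-s : ℂ) := by
    ext ξ
    rw [Real.fourier_real_eq_integral_exp_smul, ← laplace_rpow hs0 (by simp [vline_re]),
      ← integral_indicator measurableSet_Ioi]
    congr 1
    ext t
    by_cases ht : t ∈ Set.Ioi (0 : ℝ)
    · rw [hf, Set.indicator_of_mem ht, Set.indicator_of_mem ht, smul_eq_mul, mul_left_comm,
        ← Complex.exp_add]
      congr 2
      simp only [vline]
      push_cast
      ring
    · rw [hf, Set.indicator_of_notMem ht, Set.indicator_of_notMem ht, smul_zero]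
  have hcont : ContinuousAt f 1 := by
    have hc : ContinuousAt
        (fun t : ℝ => ((t ^ (s - 1) : ℝ) : ℂ) * Complex.exp (-((1 : ℂ) * t))) 1 := by
      have : ContinuousAt (fun t : ℝ => t ^ (s - 1)) 1 :=
        continuousAt_rpow_const _ _ (Or.inl one_ne_zero)
      fun_prop
    refine hc.congr ?_
    filter_upwards [Ioi_mem_nhds (zero_lt_one (α := ℝ))] with t ht
    rw [hf, Set.indicator_of_mem ht]
  have hinv := hfint.fourierInv_fourier_eq
    (by rw [hfourier]; exact (integrable_vline_cpow hs).const_mul _) hcont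
  rw [hfourier, Real.fourierInv_eq', hf, Set.indicator_of_mem (by simp)] at hinv
  have hexp : (fun ξ : ℝ => Complex.exp (vline ξ) * vline ξ ^ (-s : ℂ)) = fun ξ =>
      (Complex.exp 1 / Gamma s) * (Complex.exp (↑(2 * π * inner ℝ ξ (1 : ℝ)) * Complex.I) •
        ((Gamma s : ℂ) * vline ξ ^ (-s : ℂ))) := by
    ext ξ
    have : Complex.exp (vline ξ) = Complex.exp 1 *
        Complex.exp (↑(2 * π * inner ℝ ξ (1 : ℝ)) * Complex.I) := by
      rw [← Complex.exp_add]
      simp [vline]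
    rw [this, smul_eq_mul]
    have : (Gamma s : ℂ) ≠ 0 := by exact_mod_cast hG
    field_simp
  rw [hexp, integral_const_mul, hinv, one_rpow, Complex.ofReal_one, one_mul, mul_one,
    div_mul_eq_mul_div, ← Complex.exp_add]
  simp

/-- A convex neighbourhood of the nonnegative reals on which `1 + x * p` stays away from zero
for every `p` in the right half of the unit disc. -/
def halfStrip : Set ℂ := {x | -(1 / 4) < x.re} ∩ {x | -(1 / 4) < x.im} ∩ {x | x.im < 1 / 4}

lemma isOpen_halfStrip : IsOpen halfStrip :=
  ((isOpen_lt continuous_const Complex.continuous_re).inter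
    (isOpen_lt continuous_const Complex.continuous_im)).inter
    (isOpen_lt Complex.continuous_im continuous_const)

lemma isPreconnected_halfStrip : IsPreconnected halfStrip :=
  (((convex_halfSpace_re_gt _).inter (convex_halfSpace_im_gt _)).inter
    (convex_halfSpace_im_lt _)).isPreconnected

lemma ofReal_mem_halfStrip {x : ℝ} (hx : 0 ≤ x) : (x : ℂ) ∈ halfStrip := by
  refine ⟨⟨?_, ?_⟩, ?_⟩
  · change -(1 / 4) < (x : ℂ).re
    rw [Complex.ofReal_re]; linarith
  · change -(1 / 4) < (x : ℂ).im
    rw [Complex.ofReal_im]; norm_num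
  · change (x : ℂ).im < 1 / 4
    rw [Complex.ofReal_im]; norm_num

lemma half_le_norm_one_add_mul {x p : ℂ} (hx : x ∈ halfStrip) (hp : ‖p‖ ≤ 1) (hre : 0 ≤ p.re) :
    1 / 2 ≤ ‖1 + x * p‖ := by
  have h1 : -(1 / 4) < x.re := hx.1.1
  have h2 : -(1 / 4) < x.im := hx.1.2
  have h3 : x.im < 1 / 4 := hx.2
  have hpr : p.re ≤ 1 := (le_abs_self _).trans ((Complex.abs_re_le_norm p).trans hp)
  have hpi : |p.im| ≤ 1 := (Complex.abs_im_le_norm p).trans hp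
  have hi : x.im * p.im ≤ 1 / 4 := by
    refine (le_abs_self _).trans ?_
    rw [abs_mul]
    have : |x.im| ≤ 1 / 4 := abs_le.2 ⟨h2.le, h3.le⟩
    nlinarith [abs_nonneg x.im, abs_nonneg p.im]
  have hr : -(1 / 4) ≤ x.re * p.re := by nlinarith
  refine le_trans ?_ (Complex.re_le_norm _)
  simp only [Complex.add_re, Complex.one_re, Complex.mul_re]
  linarith

lemma mul_norm_le_norm_one_add_mul {x : ℝ} {p : ℂ} (hx : 0 ≤ x) (hre : 0 ≤ p.re) :
    x * ‖p‖ ≤ ‖1 + x * p‖ := by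
  have h : x * ‖p‖ = ‖(x : ℂ) * p‖ := by rw [norm_mul, Complex.norm_real, norm_of_nonneg hx]
  rw [h, Complex.norm_def, Complex.norm_def]
  refine sqrt_le_sqrt ?_
  simp only [Complex.normSq_apply, Complex.add_re, Complex.one_re, Complex.add_im,
    Complex.one_im, Complex.mul_re, Complex.mul_im, Complex.ofReal_re, Complex.ofReal_im,
    zero_mul, sub_zero, zero_add, add_zero]
  nlinarith [mul_nonneg hx hre]

section ResolventTransform

variable {α : Type*} [MeasurableSpace α] {μ : Measure α} {A p : α → ℂ}

lemma hasDerivAt_integral_div_one_add_mul (hA : Integrable A μ) (hp : AEStronglyMeasurable p μ)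
    (hp1 : ∀ a, ‖p a‖ ≤ 1) (hre : ∀ a, 0 < (p a).re) {x : ℂ} (hx : x ∈ halfStrip) :
    HasDerivAt (fun x : ℂ => ∫ a, A a / (1 + x * p a) ∂μ)
      (∫ a, -(A a * p a / (1 + x * p a) ^ 2) ∂μ) x := by
  have hden : ∀ y : ℂ, AEMeasurable (fun a => 1 + y * p a) μ := fun y =>
    (hp.aemeasurable.const_mul y).const_add 1
  have hmeas : ∀ y : ℂ, AEStronglyMeasurable (fun a => A a / (1 + y * p a)) μ := fun y =>
    (hA.aemeasurable.div (hden y)).aestronglyMeasurable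
  refine (hasDerivAt_integral_of_dominated_loc_of_deriv_le
    (F' := fun y a => -(A a * p a / (1 + y * p a) ^ 2)) (bound := fun a => 4 * ‖A a‖)
    (isOpen_halfStrip.mem_nhds hx) (Eventually.of_forall hmeas) ?_ ?_ ?_
    (hA.norm.const_mul 4) ?_).2
  · refine (hA.norm.const_mul 2).mono' (hmeas x) (Eventually.of_forall fun a => ?_)
    have h := half_le_norm_one_add_mul hx (hp1 a) (hre a).le
    rw [norm_div, div_le_iff₀ (by linarith)]
    nlinarith [norm_nonneg (A a)]
  · exact ((hA.aemeasurable.mul hp.aemeasurable).div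
      ((hden x).pow_const 2)).neg.aestronglyMeasurable
  · refine Eventually.of_forall fun a y hy => ?_
    have h := half_le_norm_one_add_mul hy (hp1 a) (hre a).le
    rw [norm_neg, norm_div, norm_mul, norm_pow, div_le_iff₀ (by positivity)]
    have h4 : 1 ≤ 4 * ‖1 + y * p a‖ ^ 2 := by nlinarith
    calc ‖A a‖ * ‖p a‖ ≤ ‖A a‖ * 1 := by gcongr; exact hp1 a
      _ ≤ ‖A a‖ * (4 * ‖1 + y * p a‖ ^ 2) := by gcongr
      _ = _ := by ring
  · refine Eventually.of_forall fun a y hy => ?_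
    have h := half_le_norm_one_add_mul hy (hp1 a) (hre a).le
    have hne : 1 + y * p a ≠ 0 := norm_pos_iff.1 (by linarith)
    have h1 : HasDerivAt (fun y : ℂ => 1 + y * p a) (p a) y := by
      simpa using ((hasDerivAt_id y).mul_const (p a)).const_add 1
    convert! (hasDerivAt_const y (A a)).div h1 hne using 1
    ring

lemma integral_div_one_add_mul_eq_tsum (hA : Integrable A μ) (hp : AEStronglyMeasurable p μ)
    (hp1 : ∀ a, ‖p a‖ ≤ 1) {x : ℂ} (hx : ‖x‖ < 1) :
    ∫ a, A a / (1 + x * p a) ∂μ = ∑' k : ℕ, (-x) ^ k * ∫ a, A a * p a ^ k ∂μ := by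
  have hle : ∀ (k : ℕ) (a : α), ‖(-x) ^ k * (A a * p a ^ k)‖ ≤ ‖x‖ ^ k * ‖A a‖ := by
    intro k a
    rw [norm_mul, norm_pow, norm_neg, norm_mul, norm_pow]
    gcongr
    exact mul_le_of_le_one_right (norm_nonneg _) (pow_le_one₀ (norm_nonneg _) (hp1 a))
  have hint : ∀ k : ℕ, Integrable (fun a => (-x) ^ k * (A a * p a ^ k)) μ := fun k =>
    (hA.norm.const_mul (‖x‖ ^ k)).mono' ((hA.aemeasurable.mul
      (hp.aemeasurable.pow_const k)).const_mul _).aestronglyMeasurable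
      (Eventually.of_forall (hle k))
  have hsum : Summable fun k : ℕ => ∫ a, ‖(-x) ^ k * (A a * p a ^ k)‖ ∂μ := by
    refine Summable.of_nonneg_of_le (fun k => integral_nonneg fun a => norm_nonneg _) (fun k => ?_)
      ((summable_geometric_of_lt_one (norm_nonneg x) hx).mul_right (∫ a, ‖A a‖ ∂μ))
    rw [← integral_const_mul]
    exact integral_mono (hint k).norm (hA.norm.const_mul _) (hle k)
  have h := (hasSum_integral_of_summable_integral_norm hint hsum).tsum_eq
  simp_rw [integral_const_mul] at h
  rw [h]
  congr 1
  ext a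
  have hlt : ‖-x * p a‖ < 1 := by
    rw [norm_mul, norm_neg]
    exact (mul_le_of_le_one_right (norm_nonneg _) (hp1 a)).trans_lt hx
  calc A a / (1 + x * p a) = A a * (1 - -x * p a)⁻¹ := by rw [div_eq_mul_inv]; ring_nf
    _ = A a * ∑' k : ℕ, (-x * p a) ^ k := by rw [tsum_geometric_of_norm_lt_one hlt]
    _ = _ := by
      rw [← tsum_mul_left]
      congr 1
      ext k
      rw [mul_pow]
      ring

lemma tendsto_mul_div_one_add_mul {p : ℂ} (hp : p ≠ 0) :
    Tendsto (fun x : ℝ => (x : ℂ) / (1 + x * p)) atTop (𝓝 p⁻¹) := by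
  have h0 : Tendsto (fun x : ℝ => ((x⁻¹ : ℝ) : ℂ)) atTop (𝓝 0) := by
    have := (Complex.continuous_ofReal.tendsto 0).comp (tendsto_inv_atTop_zero (𝕜 := ℝ))
    simpa [Function.comp_def] using this
  have h1 : Tendsto (fun x : ℝ => (((x⁻¹ : ℝ) : ℂ) + p)⁻¹) atTop (𝓝 p⁻¹) := by
    have := (h0.add_const p).inv₀ (by simpa using hp)
    simpa using this
  refine h1.congr' ?_
  filter_upwards [eventually_gt_atTop 0] with x hx
  have : (x : ℂ) ≠ 0 := by exact_mod_cast hx.ne'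
  push_cast
  rw [div_eq_mul_inv, ← inv_inj, inv_inv, mul_inv, inv_inv, mul_add, inv_mul_cancel_left₀ this,
    mul_one]

lemma tendsto_mul_integral_div_one_add_mul (hA : Integrable A μ)
    (hp : AEStronglyMeasurable p μ) (hre : ∀ a, 0 < (p a).re)
    (hAp : Integrable (fun a => A a / p a) μ) :
    Tendsto (fun x : ℝ => (x : ℂ) * ∫ a, A a / (1 + x * p a) ∂μ) atTop
      (𝓝 (∫ a, A a / p a ∂μ)) := by
  have hne : ∀ a, p a ≠ 0 := fun a => Complex.ne_zero_of_re_pos (hre a)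
  simp_rw [← integral_const_mul]
  refine tendsto_integral_filter_of_dominated_convergence (fun a => ‖A a / p a‖)
    (Eventually.of_forall fun x => ?_) ?_ hAp.norm (Eventually.of_forall fun a => ?_)
  · exact ((hA.aemeasurable.div ((hp.aemeasurable.const_mul _).const_add 1)).const_mul
      _).aestronglyMeasurable
  · filter_upwards [eventually_gt_atTop 0] with x hx
    refine Eventually.of_forall fun a => ?_
    have h := mul_norm_le_norm_one_add_mul hx.le (hre a).le
    have hpa : 0 < ‖p a‖ := norm_pos_iff.2 (hne a)
    rw [norm_mul, norm_div, norm_div, Complex.norm_real, norm_of_nonneg hx.le]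
    calc x * (‖A a‖ / ‖1 + x * p a‖) ≤ x * (‖A a‖ / (x * ‖p a‖)) := by gcongr
      _ = ‖A a‖ / ‖p a‖ := by field_simp
  · have := (tendsto_mul_div_one_add_mul (hne a)).const_mul (A a)
    simpa only [← div_eq_mul_inv, mul_div_assoc', mul_comm] using this

lemma tendsto_sq_mul_integral_div_one_add_mul_sq (hA : Integrable A μ)
    (hp : AEStronglyMeasurable p μ) (hre : ∀ a, 0 < (p a).re)
    (hAp : Integrable (fun a => A a / p a) μ) :
    Tendsto (fun x : ℝ => (x : ℂ) ^ 2 * ∫ a, -(A a * p a / (1 + x * p a) ^ 2) ∂μ) atTop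
      (𝓝 (-∫ a, A a / p a ∂μ)) := by
  have hne : ∀ a, p a ≠ 0 := fun a => Complex.ne_zero_of_re_pos (hre a)
  simp_rw [← integral_const_mul, ← integral_neg]
  refine tendsto_integral_filter_of_dominated_convergence (fun a => ‖A a / p a‖)
    (Eventually.of_forall fun x => ?_) ?_ hAp.norm (Eventually.of_forall fun a => ?_)
  · exact ((((hA.aemeasurable.mul hp.aemeasurable).div
      (((hp.aemeasurable.const_mul _).const_add 1).pow_const 2)).neg).const_mul
      _).aestronglyMeasurable
  · filter_upwards [eventually_gt_atTop 0] with x hx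
    refine Eventually.of_forall fun a => ?_
    have h := mul_norm_le_norm_one_add_mul hx.le (hre a).le
    have hpa : 0 < ‖p a‖ := norm_pos_iff.2 (hne a)
    rw [norm_mul, norm_neg, norm_div, norm_div, norm_mul, norm_pow, norm_pow, Complex.norm_real,
      norm_of_nonneg hx.le]
    calc x ^ 2 * (‖A a‖ * ‖p a‖ / ‖1 + x * p a‖ ^ 2)
        ≤ x ^ 2 * (‖A a‖ * ‖p a‖ / (x * ‖p a‖) ^ 2) := by gcongr
      _ = ‖A a‖ / ‖p a‖ := by field_simp
  · have := (((tendsto_mul_div_one_add_mul (hne a)).pow 2).const_mul (A a * p a)).neg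
    convert! this using 2
    · rw [div_pow]
      ring
    · have := hne a
      field_simp

end ResolventTransform

lemma vline_cpow_neg_re_pos {δ : ℝ} (hδ0 : 0 < δ) (hδ1 : δ < 1) (ξ : ℝ) :
    0 < (vline ξ ^ (-δ : ℂ)).re := by
  have harg : |(vline ξ).arg| < π / 2 := by
    rw [Complex.abs_arg_lt_pi_div_two_iff]
    exact Or.inl (by simp [vline_re])
  rw [← Complex.ofReal_neg, Complex.cpow_ofReal_re]
  refine mul_pos (rpow_pos_of_pos (norm_pos_iff.2 (vline_ne_zero ξ)) _) (cos_pos_of_mem_Ioo ?_)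
  have h : |(vline ξ).arg * -δ| < π / 2 := by
    rw [abs_mul, abs_neg, abs_of_pos hδ0]
    nlinarith [abs_nonneg (vline ξ).arg]
  exact abs_lt.1 h

lemma norm_vline_cpow_neg_le_one {δ : ℝ} (hδ0 : 0 < δ) (ξ : ℝ) : ‖vline ξ ^ (-δ : ℂ)‖ ≤ 1 := by
  rw [← Complex.ofReal_neg, norm_vline_cpow]
  exact rpow_le_one_of_one_le_of_nonpos (one_le_norm_vline ξ) (by linarith)

lemma integrable_exp_mul_vline_cpow {s : ℝ} (hs : 1 < s) :
    Integrable fun ξ : ℝ => Complex.exp (vline ξ) * vline ξ ^ (-s : ℂ) := by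
  refine (integrable_vline_cpow hs).bdd_mul (c := exp 1)
    (Complex.continuous_exp.comp continuous_vline).aestronglyMeasurable
    (Eventually.of_forall fun ξ => ?_)
  rw [Complex.norm_exp, vline_re]

/-- On the nonnegative half-line, `x ↦ E_{δ,b}(-x)` is differentiable, and it and its derivative
have the leading-order behaviour `1 / (Γ(b - δ) x)` and `-1 / (Γ(b - δ) x²)` at infinity. -/
lemma exists_hasDerivAt_ML_neg_and_tendsto {δ b : ℝ} (hδ0 : 0 < δ) (hδ1 : δ < 1)
    (hb : 1 + δ < b) :
    ∃ E' : ℝ → ℝ, (∀ x, 0 ≤ x → HasDerivAt (fun x => ML δ b (-x)) (E' x) x) ∧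
      Tendsto (fun x => x * ML δ b (-x)) atTop (𝓝 (1 / Gamma (b - δ))) ∧
      Tendsto (fun x => x ^ 2 * E' x) atTop (𝓝 (-(1 / Gamma (b - δ)))) := by
  set A : ℝ → ℂ := fun ξ => Complex.exp (vline ξ) * vline ξ ^ (-b : ℂ) with hAdef
  set p : ℝ → ℂ := fun ξ => vline ξ ^ (-δ : ℂ) with hpdef
  have hA : Integrable A := integrable_exp_mul_vline_cpow (by linarith)
  have hp : AEStronglyMeasurable p volume := (continuous_vline_cpow _).aestronglyMeasurable
  have hp1 : ∀ ξ, ‖p ξ‖ ≤ 1 := norm_vline_cpow_neg_le_one hδ0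
  have hre : ∀ ξ, 0 < (p ξ).re := vline_cpow_neg_re_pos hδ0 hδ1
  have hApeq : (fun ξ => A ξ / p ξ)
      = fun ξ => Complex.exp (vline ξ) * vline ξ ^ (-(b - δ : ℝ) : ℂ) := by
    ext ξ
    rw [hAdef, hpdef]
    simp only
    rw [mul_div_assoc, ← Complex.cpow_sub _ _ (vline_ne_zero ξ)]
    push_cast
    ring_nf
  have hAp : Integrable fun ξ => A ξ / p ξ := by
    rw [hApeq]
    exact integrable_exp_mul_vline_cpow (by linarith)
  have hApval : ∫ ξ, A ξ / p ξ = ((1 / Gamma (b - δ) : ℝ) : ℂ) := by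
    rw [hApeq, integral_exp_mul_vline_cpow (by linarith)]
    push_cast
    rfl
  have hmoment : ∀ k : ℕ, ∫ ξ, A ξ * p ξ ^ k = 1 / (Gamma (k * δ + b) : ℂ) := by
    intro k
    have hkδ : 0 ≤ k * δ := by positivity
    rw [← integral_exp_mul_vline_cpow (by linarith)]
    congr 1
    ext ξ
    rw [hAdef, hpdef]
    simp only
    rw [← Complex.cpow_nat_mul, mul_assoc, ← Complex.cpow_add _ _ (vline_ne_zero ξ)]
    push_cast
    ring_nf
  have hEq : Set.EqOn (fun z : ℂ => ∑' k : ℕ, (-z) ^ k / (Gamma (k * δ + b) : ℂ))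
      (fun z : ℂ => ∫ ξ, A ξ / (1 + z * p ξ)) halfStrip := by
    have hd : Differentiable ℂ (fun z : ℂ => ∑' k : ℕ, (-z) ^ k / (Gamma (k * δ + b) : ℂ)) :=
      (differentiable_tsum_pow_div_Gamma hδ0 (by linarith)).comp differentiable_neg
    refine (hd.differentiableOn.analyticOnNhd isOpen_halfStrip).eqOn_of_preconnected_of_eventuallyEq
      (DifferentiableOn.analyticOnNhd (fun z hz => (hasDerivAt_integral_div_one_add_mul hA hp hp1
        hre hz).differentiableAt.differentiableWithinAt) isOpen_halfStrip)
      isPreconnected_halfStrip (z₀ := 0) (by simpa using ofReal_mem_halfStrip le_rfl) ?_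
    filter_upwards [Metric.ball_mem_nhds (0 : ℂ) one_pos] with z hz
    rw [mem_ball_zero_iff] at hz
    rw [integral_div_one_add_mul_eq_tsum hA hp hp1 hz]
    simp_rw [hmoment, mul_one_div]
  have hML : ∀ x : ℝ, 0 ≤ x → (ML δ b (-x) : ℂ) = ∫ ξ, A ξ / (1 + x * p ξ) := by
    intro x hx
    refine Eq.trans ?_ (hEq (ofReal_mem_halfStrip hx))
    rw [ofReal_ML]
    push_cast
    rfl
  refine ⟨fun x => (∫ ξ, -(A ξ * p ξ / (1 + x * p ξ) ^ 2)).re, fun x hx => ?_, ?_, ?_⟩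
  · have hx' := ofReal_mem_halfStrip hx
    have h := (hasDerivAt_integral_div_one_add_mul hA hp hp1 hre hx').congr_of_eventuallyEq
      (hEq.eventuallyEq_of_mem (isOpen_halfStrip.mem_nhds hx'))
    refine h.real_of_complex.congr_of_eventuallyEq (Eventually.of_forall fun y => ?_)
    change ML δ b (-y) = _
    rw [← Complex.ofReal_re (ML δ b (-y)), ofReal_ML]
    push_cast
    rfl
  · have h := (Complex.continuous_re.tendsto _).comp
      (tendsto_mul_integral_div_one_add_mul hA hp hre hAp)
    rw [hApval, Complex.ofReal_re] at h
    refine h.congr' ?_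
    filter_upwards [eventually_ge_atTop 0] with x hx
    rw [Function.comp_apply, ← hML x hx, ← Complex.ofReal_mul, Complex.ofReal_re]
  · have h := (Complex.continuous_re.tendsto _).comp
      (tendsto_sq_mul_integral_div_one_add_mul_sq hA hp hre hAp)
    rw [hApval, ← Complex.ofReal_neg, Complex.ofReal_re] at h
    refine h.congr fun x => ?_
    rw [Function.comp_apply, ← Complex.ofReal_pow, Complex.re_ofReal_mul]

lemma exists_hasDerivAt_Ufun_and_tendsto {a1 a2 C1 C2 : ℝ} (ha2 : 0 < a2) (ha12 : a2 < a1)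
    (ha1 : a1 < 1) (hC1 : 0 < C1) (hC2 : 0 < C2) :
    ∃ U' : ℝ → ℝ, (∀ t, 0 < t → HasDerivAt (Ufun a1 a2 C1 C2) (U' t) t) ∧
      Tendsto (fun t => t ^ (1 - a2) * U' t) atTop (𝓝 (1 / (C2 * Gamma a2))) := by
  obtain ⟨E', hE', hlim, hlim'⟩ := exists_hasDerivAt_ML_neg_and_tendsto (δ := a1 - a2)
    (b := a1 + 1) (by linarith) (by linarith) (by linarith)
  set δ := a1 - a2 with hδ
  have hδ0 : 0 < δ := by linarith
  set c := C2 / C1 with hc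
  have hc0 : 0 < c := by positivity
  have hU : Ufun a1 a2 C1 C2 = fun t => t ^ a1 / C1 * ML δ (a1 + 1) (-(c * t ^ δ)) := by
    ext t
    rw [Ufun, hc]
    congr 2
    ring
  refine ⟨fun t => a1 * t ^ (a1 - 1) / C1 * ML δ (a1 + 1) (-(c * t ^ δ)) +
    t ^ a1 / C1 * (E' (c * t ^ δ) * (c * (δ * t ^ (δ - 1)))), fun t ht => ?_, ?_⟩
  · rw [hU]
    have h1 := (hasDerivAt_rpow_const (p := a1) (Or.inl ht.ne')).div_const C1
    have h2 := (hasDerivAt_rpow_const (p := δ) (Or.inl ht.ne')).const_mul c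
    exact h1.mul (HasDerivAt.comp (h₂ := fun x => ML δ (a1 + 1) (-x)) t
      (hE' (c * t ^ δ) (by positivity)) h2)
  · have hx : Tendsto (fun t : ℝ => c * t ^ δ) atTop atTop :=
      (tendsto_rpow_atTop hδ0).const_mul_atTop hc0
    have h := ((hlim.comp hx).const_mul (a1 / C2)).add ((hlim'.comp hx).const_mul (δ / C2))
    have hval : a1 / C2 * (1 / Gamma (a1 + 1 - δ)) + δ / C2 * -(1 / Gamma (a1 + 1 - δ))
        = 1 / (C2 * Gamma a2) := by
      have : a1 + 1 - δ = a2 + 1 := by rw [hδ]; ring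
      have hG := (Gamma_pos_of_pos ha2).ne'
      rw [this, Gamma_add_one ha2.ne', hδ]
      field_simp
      ring
    rw [hval] at h
    refine h.congr' ?_
    filter_upwards [eventually_gt_atTop 0] with t ht
    have e1 : t ^ (1 - a2) * t ^ (a1 - 1) = t ^ δ := by
      rw [← rpow_add ht]; congr 1; rw [hδ]; ring
    have e2 : t ^ (1 - a2) * (t ^ a1 * t ^ (δ - 1)) = (t ^ δ) ^ 2 := by
      rw [← rpow_add ht, ← rpow_add ht, ← rpow_mul_natCast ht.le]
      congr 1; rw [hδ]; push_cast; ring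
    simp only [Function.comp_apply]
    generalize ML δ (a1 + 1) (-(c * t ^ δ)) = m
    generalize E' (c * t ^ δ) = e
    calc _ = a1 / C1 * t ^ δ * m + c * δ / C1 * (t ^ δ) ^ 2 * e := by
          rw [hc]; field_simp
      _ = a1 / C1 * (t ^ (1 - a2) * t ^ (a1 - 1)) * m
          + c * δ / C1 * (t ^ (1 - a2) * (t ^ a1 * t ^ (δ - 1))) * e := by rw [e1, e2]
      _ = _ := by ring

section PowerKernel

variable {δ c : ℝ}

lemma rpow_mul_neg_mul_pow {t : ℝ} (ht : 0 < t) (r : ℝ) (k : ℕ) :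
    t ^ r * (-(c * t ^ δ)) ^ k = (-c) ^ k * t ^ (k * δ + r) := by
  rw [← neg_mul, mul_pow, ← rpow_mul_natCast ht.le, mul_left_comm, ← rpow_add ht]
  ring_nf

lemma continuous_ML_neg_rpow (hδ : 0 < δ) {b : ℝ} (hb : 0 < b) :
    Continuous fun t : ℝ => ML δ b (-(c * t ^ δ)) :=
  (continuous_ML hδ hb).comp
    ((continuous_const.mul (continuous_id.rpow_const fun _ => Or.inr hδ.le)).neg)

lemma integral_rpow_mul_rpow_mul_ML (hδ : 0 < δ) (hc : 0 < c) {b m s : ℝ} (hb : 0 < b)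
    (hm : 0 ≤ m) (hs : 0 < s) :
    ∫ t in (0 : ℝ)..s, t ^ m * (t ^ (b - 1) * ML δ b (-(c * t ^ δ)))
      = s ^ (b + m) * ∑' k : ℕ,
        (-(c * s ^ δ)) ^ k / ((k * δ + b + m) * Gamma (k * δ + b)) := by
  have hG : ∀ k : ℕ, 0 < Gamma (k * δ + b) := fun k => Gamma_pos_of_pos (by positivity)
  have hint : ∀ k : ℕ, IntegrableOn (fun t : ℝ => t ^ (k * δ + (b + m - 1))) (Set.Ioc 0 s) := by
    intro k
    have hk : 0 ≤ k * δ := by positivity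
    exact (intervalIntegrable_iff_integrableOn_Ioc_of_le hs.le).1
      (intervalIntegral.intervalIntegrable_rpow' (by linarith))
  have hval : ∀ k : ℕ, ∫ t in Set.Ioc 0 s, t ^ (k * δ + (b + m - 1))
      = s ^ (k * δ + (b + m)) / (k * δ + b + m) := by
    intro k
    have hk : 0 ≤ k * δ := by positivity
    rw [← intervalIntegral.integral_of_le hs.le, integral_rpow (Or.inl (by linarith)),
      show k * δ + (b + m - 1) + 1 = k * δ + (b + m) by ring, zero_rpow (by linarith), sub_zero,
      add_assoc]
  have hsum : Summable fun k : ℕ => ∫ t in Set.Ioc 0 s,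
      ‖(-c) ^ k / Gamma (k * δ + b) * t ^ (k * δ + (b + m - 1))‖ := by
    have heq : ∀ k : ℕ, ∫ t in Set.Ioc 0 s,
        ‖(-c) ^ k / Gamma (k * δ + b) * t ^ (k * δ + (b + m - 1))‖
        = c ^ k / Gamma (k * δ + b) * (s ^ (k * δ + (b + m)) / (k * δ + b + m)) := by
      intro k
      rw [← hval, ← integral_const_mul]
      refine setIntegral_congr_fun measurableSet_Ioc fun t ht => ?_
      rw [norm_mul, norm_div, norm_pow, norm_neg, norm_of_nonneg hc.le,
        norm_of_nonneg (hG k).le, norm_of_nonneg (rpow_nonneg ht.1.le _)]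
    simp_rw [heq]
    refine Summable.of_nonneg_of_le (fun k => ?_) (fun k => ?_)
      ((summable_pow_div_Gamma hδ hb (c * s ^ δ)).mul_left (s ^ (b + m) / b))
    · have := hG k
      positivity
    · have := hG k
      rw [rpow_add hs, abs_of_pos (by positivity), mul_pow, ← rpow_mul_natCast hs.le,
        mul_comm δ]
      calc c ^ k / Gamma (k * δ + b) * (s ^ (k * δ) * s ^ (b + m) / (k * δ + b + m))
          ≤ c ^ k / Gamma (k * δ + b) * (s ^ (k * δ) * s ^ (b + m) / b) := by
            gcongr
            nlinarith [mul_nonneg (k.cast_nonneg (α := ℝ)) hδ.le]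
        _ = _ := by ring
  have h := (hasSum_integral_of_summable_integral_norm
    (fun k => (hint k).const_mul ((-c) ^ k / Gamma (k * δ + b))) hsum).tsum_eq
  rw [intervalIntegral.integral_of_le hs.le]
  refine Eq.trans (setIntegral_congr_fun measurableSet_Ioc fun t ht => ?_)
    (h.symm.trans ?_)
  · rw [ML, ← mul_assoc, ← rpow_add ht.1, ← tsum_mul_left]
    congr 1
    ext k
    rw [mul_div_assoc', rpow_mul_neg_mul_pow ht.1, mul_div_right_comm]
    ring_nf
  · rw [← tsum_mul_left]
    congr 1
    ext k
    rw [integral_const_mul, hval, mul_div_assoc' (s ^ (b + m)), rpow_mul_neg_mul_pow hs]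
    have := (hG k).ne'
    have : k * δ + b + m ≠ 0 := by positivity
    field_simp

lemma integral_rpow_mul_ML (hδ : 0 < δ) (hc : 0 < c) {b s : ℝ} (hb : 0 < b) (hs : 0 < s) :
    ∫ t in (0 : ℝ)..s, t ^ (b - 1) * ML δ b (-(c * t ^ δ))
      = s ^ b * ML δ (b + 1) (-(c * s ^ δ)) := by
  have h := integral_rpow_mul_rpow_mul_ML hδ hc hb le_rfl hs
  simp only [rpow_zero, one_mul, add_zero] at h
  rw [h, ML]
  congr 2
  ext k
  rw [← add_assoc, Gamma_add_one (by positivity)]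

lemma integral_mul_rpow_mul_ML (hδ : 0 < δ) (hc : 0 < c) {b s : ℝ} (hb : 0 < b) (hs : 0 < s) :
    ∫ t in (0 : ℝ)..s, t * (t ^ (b - 1) * ML δ b (-(c * t ^ δ)))
      = s ^ (b + 1) * ∑' k : ℕ,
        (k * δ + b) * (-(c * s ^ δ)) ^ k / Gamma (k * δ + b + 2) := by
  have h := integral_rpow_mul_rpow_mul_ML hδ hc hb zero_le_one hs
  simp only [rpow_one] at h
  rw [h]
  congr 2
  ext k
  have hk : 0 < k * δ + b := by positivity
  have := (Gamma_pos_of_pos hk).ne'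
  rw [show k * δ + b + 2 = k * δ + b + 1 + 1 by ring, Gamma_add_one (by positivity),
    Gamma_add_one hk.ne']
  field_simp

lemma integral_sub_rpow_mul_rpow {p q s : ℝ} (hp : 0 < p) (hq : 0 < q) (hs : 0 < s) :
    ∫ t in (0 : ℝ)..s, (s - t) ^ (q - 1) * t ^ (p - 1)
      = s ^ (p + q - 1) * (Gamma p * Gamma q / Gamma (p + q)) := by
  have h := Complex.betaIntegral_scaled p q hs
  have hb : Complex.betaIntegral p q = ((Gamma p * Gamma q / Gamma (p + q) : ℝ) : ℂ) := by
    have hG : Complex.Gamma (p + q) ≠ 0 := by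
      rw [← Complex.ofReal_add, Complex.Gamma_ofReal]
      exact_mod_cast (Gamma_pos_of_pos (add_pos hp hq)).ne'
    have := Complex.Gamma_mul_Gamma_eq_betaIntegral (s := p) (t := q) (by simpa) (by simpa)
    rw [← mul_right_inj' hG, ← this]
    rw [← Complex.ofReal_add, Complex.Gamma_ofReal] at hG ⊢
    rw [Complex.Gamma_ofReal, Complex.Gamma_ofReal]
    push_cast
    field_simp
  rw [← Complex.ofReal_inj, ← intervalIntegral.integral_ofReal]
  rw [hb] at h
  push_cast
  rw [Complex.ofReal_cpow hs.le]
  push_cast at h ⊢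
  rw [← h]
  refine intervalIntegral.integral_congr fun t ht => ?_
  rw [Set.uIcc_of_le hs.le] at ht
  rw [Complex.ofReal_cpow ht.1, Complex.ofReal_cpow (sub_nonneg.2 ht.2)]
  push_cast
  ring

lemma intervalIntegrable_sub_rpow_mul_rpow {p q s : ℝ} (hp : 0 < p) (hq : 0 < q) (hs : 0 < s) :
    IntervalIntegrable (fun t => (s - t) ^ (q - 1) * t ^ (p - 1)) volume 0 s := by
  by_contra hni
  have h := integral_sub_rpow_mul_rpow hp hq hs
  rw [intervalIntegral.integral_undef hni] at h
  have := Gamma_pos_of_pos hp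
  have := Gamma_pos_of_pos hq
  have := Gamma_pos_of_pos (add_pos hp hq)
  exact (show (0 : ℝ) < s ^ (p + q - 1) * (Gamma p * Gamma q / Gamma (p + q)) by
    positivity).ne h

/-- The convolution of two Mittag-Leffler kernels is a second-order Mittag-Leffler kernel. -/
lemma integral_convolution_rpow_mul_ML (hδ : 0 < δ) (hc : 0 < c) {b d s : ℝ} (hb : 0 < b)
    (hd : 0 < d) (hs : 0 < s) :
    ∫ t in (0 : ℝ)..s, ((s - t) ^ (d - 1) * ML δ d (-(c * (s - t) ^ δ))) *
        (t ^ (b - 1) * ML δ b (-(c * t ^ δ)))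
      = s ^ (b + d - 1) * ML2 δ (b + d) (-(c * s ^ δ)) := by
  set H : ℕ → ℝ → ℝ := fun n t => ∑ kl ∈ Finset.HasAntidiagonal.antidiagonal n,
    1 / (Gamma (kl.1 * δ + d) * Gamma (kl.2 * δ + b)) *
      ((s - t) ^ (kl.1 * δ + d - 1) * t ^ (kl.2 * δ + b - 1)) with hH
  have hG : ∀ k : ℕ, ∀ {r : ℝ}, 0 < r → 0 < Gamma (k * δ + r) :=
    fun k r hr => Gamma_pos_of_pos (by positivity)
  have hHint : ∀ n, IntervalIntegrable (H n) volume 0 s := by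
    intro n
    have h := IntervalIntegrable.sum (μ := volume) (a := 0) (b := s)
      (Finset.HasAntidiagonal.antidiagonal n)
      (f := fun kl t => 1 / (Gamma (kl.1 * δ + d) * Gamma (kl.2 * δ + b)) *
        ((s - t) ^ (kl.1 * δ + d - 1) * t ^ (kl.2 * δ + b - 1)))
      fun kl _ => (intervalIntegrable_sub_rpow_mul_rpow
        (by positivity) (by positivity) hs).const_mul _
    convert! h using 1
    ext t
    rw [Finset.sum_apply]
  have hHval : ∀ n : ℕ, ∫ t in (0 : ℝ)..s, H n t
      = (n + 1) * s ^ (n * δ + (b + d - 1)) / Gamma (n * δ + (b + d)) := by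
    intro n
    rw [hH]
    simp only
    rw [intervalIntegral.integral_finsetSum fun kl _ => (intervalIntegrable_sub_rpow_mul_rpow
      (by positivity) (by positivity) hs).const_mul _]
    have : ∀ kl ∈ Finset.HasAntidiagonal.antidiagonal n, (∫ t in (0 : ℝ)..s,
        1 / (Gamma (kl.1 * δ + d) * Gamma (kl.2 * δ + b)) *
          ((s - t) ^ (kl.1 * δ + d - 1) * t ^ (kl.2 * δ + b - 1)))
        = s ^ (n * δ + (b + d - 1)) / Gamma (n * δ + (b + d)) := by
      intro kl hkl
      have h1 := (hG kl.1 hd).ne'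
      have h2 := (hG kl.2 hb).ne'
      have hn : (n : ℝ) = kl.1 + kl.2 := by
        rw [← Finset.HasAntidiagonal.mem_antidiagonal.1 hkl]; push_cast; ring
      rw [intervalIntegral.integral_const_mul,
        integral_sub_rpow_mul_rpow (by positivity) (by positivity) hs, hn,
        show (kl.2 : ℝ) * δ + b + (kl.1 * δ + d) = (kl.1 + kl.2) * δ + (b + d) by ring]
      have h3 := (Gamma_pos_of_pos (s := ((kl.1 : ℝ) + kl.2) * δ + (b + d)) (by positivity)).ne'
      rw [add_sub_assoc]
      field_simp
    rw [Finset.sum_congr rfl this, Finset.sum_const, Finset.Nat.card_antidiagonal, nsmul_eq_mul]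
    push_cast
    ring
  have hHnn : ∀ n, ∀ t ∈ Set.Ioo 0 s, 0 ≤ H n t := fun n t ht =>
    Finset.sum_nonneg fun kl _ => by
      have h1 := hG kl.1 hd
      have h2 := hG kl.2 hb
      have h3 := rpow_nonneg (sub_nonneg.2 ht.2.le) (kl.1 * δ + d - 1)
      have h4 := rpow_nonneg ht.1.le (kl.2 * δ + b - 1)
      positivity
  have hHval' : ∀ n : ℕ, ∫ t in Set.Ioo 0 s, H n t
      = (n + 1) * s ^ (n * δ + (b + d - 1)) / Gamma (n * δ + (b + d)) := by
    intro n
    rw [← hHval, intervalIntegral.integral_of_le hs.le, integral_Ioc_eq_integral_Ioo]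
  have hHint' : ∀ n, IntegrableOn (H n) (Set.Ioo 0 s) := fun n =>
    (intervalIntegrable_iff_integrableOn_Ioo_of_le hs.le).1 (hHint n)
  have hsum : Summable fun n : ℕ => ∫ t in Set.Ioo 0 s, ‖(-c) ^ n * H n t‖ := by
    have heq : ∀ n : ℕ, ∫ t in Set.Ioo 0 s, ‖(-c) ^ n * H n t‖
        = s ^ (b + d - 1) * ((n + 1) * |c * s ^ δ| ^ n / Gamma (n * δ + (b + d))) := by
      intro n
      rw [abs_of_pos (by positivity), mul_pow, ← rpow_mul_natCast hs.le, mul_comm δ]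
      calc ∫ t in Set.Ioo 0 s, ‖(-c) ^ n * H n t‖ = ∫ t in Set.Ioo 0 s, c ^ n * H n t := by
            refine setIntegral_congr_fun measurableSet_Ioo fun t ht => ?_
            rw [norm_mul, norm_pow, norm_neg, norm_of_nonneg hc.le, norm_of_nonneg (hHnn n t ht)]
        _ = _ := by
            rw [integral_const_mul, hHval', rpow_add hs]
            ring
    simp_rw [heq]
    exact (summable_succ_mul_pow_div_Gamma hδ (by positivity) (c * s ^ δ)).mul_left _
  have h := (hasSum_integral_of_summable_integral_norm
    (fun n => (hHint' n).const_mul ((-c) ^ n)) hsum).tsum_eq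
  have hnorm : ∀ {r : ℝ}, 0 < r → ∀ x : ℝ,
      Summable fun k : ℕ => ‖x ^ k / Gamma (k * δ + r)‖ := by
    intro r hr x
    refine (summable_pow_div_Gamma hδ hr x).congr fun k => ?_
    rw [norm_div, norm_pow, norm_of_nonneg (hG k hr).le, norm_eq_abs]
  rw [intervalIntegral.integral_of_le hs.le, integral_Ioc_eq_integral_Ioo]
  refine Eq.trans (setIntegral_congr_fun measurableSet_Ioo fun t ht => ?_) (h.symm.trans ?_)
  · have hst : 0 < s - t := sub_pos.2 ht.2
    rw [mul_mul_mul_comm, ML, ML, tsum_mul_tsum_eq_tsum_sum_antidiagonal_of_summable_norm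
      (hnorm hd _) (hnorm hb _), ← tsum_mul_left]
    congr 1
    ext n
    rw [hH, Finset.mul_sum, Finset.mul_sum]
    refine Finset.sum_congr rfl fun kl hkl => ?_
    rw [← Finset.HasAntidiagonal.mem_antidiagonal.1 hkl, pow_add]
    have e1 := rpow_mul_neg_mul_pow (c := c) (δ := δ) hst (d - 1) kl.1
    have e2 := rpow_mul_neg_mul_pow (c := c) (δ := δ) ht.1 (b - 1) kl.2
    rw [← add_sub_assoc] at e1 e2
    calc _ = ((s - t) ^ (d - 1) * (-(c * (s - t) ^ δ)) ^ kl.1) *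
          (t ^ (b - 1) * (-(c * t ^ δ)) ^ kl.2) /
            (Gamma (kl.1 * δ + d) * Gamma (kl.2 * δ + b)) := by ring
      _ = _ := by rw [e1, e2]; ring
  · rw [ML2, ← tsum_mul_left]
    congr 1
    ext n
    have e := rpow_mul_neg_mul_pow (c := c) (δ := δ) hs (b + d - 1) n
    rw [integral_const_mul, hHval']
    calc _ = (n + 1) * ((-c) ^ n * s ^ (n * δ + (b + d - 1))) / Gamma (n * δ + (b + d)) := by ring
      _ = _ := by rw [← e]; ring

end PowerKernel

section RenewalFunction

variable {a1 a2 C1 C2 : ℝ}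

lemma ufun_eq_div (t : ℝ) : ufun a1 a2 C1 C2 t =
    t ^ (a1 - 1) * ML (a1 - a2) a1 (-(C2 / C1 * t ^ (a1 - a2))) / C1 := by
  rw [ufun, show -C2 * t ^ (a1 - a2) / C1 = -(C2 / C1 * t ^ (a1 - a2)) by ring]
  ring

lemma Ufun_eq_div (t : ℝ) : Ufun a1 a2 C1 C2 t =
    t ^ a1 * ML (a1 - a2) (a1 + 1) (-(C2 / C1 * t ^ (a1 - a2))) / C1 := by
  rw [Ufun, show -C2 * t ^ (a1 - a2) / C1 = -(C2 / C1 * t ^ (a1 - a2)) by ring]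
  ring

lemma continuous_Ufun (ha1 : 0 < a1) (ha12 : a2 < a1) : Continuous (Ufun a1 a2 C1 C2) := by
  have hδ := sub_pos.2 ha12
  rw [funext Ufun_eq_div]
  exact ((continuous_rpow_const ha1.le).mul
    (continuous_ML_neg_rpow hδ (by positivity))).div_const _

lemma intervalIntegrable_ufun (ha1 : 0 < a1) (ha12 : a2 < a1) (x y : ℝ) :
    IntervalIntegrable (ufun a1 a2 C1 C2) volume x y := by
  have hδ := sub_pos.2 ha12
  rw [funext ufun_eq_div]
  exact ((intervalIntegral.intervalIntegrable_rpow' (by linarith)).mul_continuousOn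
    (continuous_ML_neg_rpow hδ ha1).continuousOn).div_const _

lemma integral_ufun (ha1 : 0 < a1) (ha12 : a2 < a1) (hC1 : 0 < C1) (hC2 : 0 < C2)
    {s : ℝ} (hs : 0 < s) : ∫ τ in (0 : ℝ)..s, ufun a1 a2 C1 C2 τ = Ufun a1 a2 C1 C2 s := by
  simp_rw [ufun_eq_div]
  rw [intervalIntegral.integral_div,
    integral_rpow_mul_ML (sub_pos.2 ha12) (div_pos hC2 hC1) ha1 hs, Ufun_eq_div]

lemma integral_mul_ufun (ha1 : 0 < a1) (ha12 : a2 < a1) (hC1 : 0 < C1) (hC2 : 0 < C2)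
    {s : ℝ} (hs : 0 < s) :
    1 / (C2 * Gamma a2) * ∫ τ in (0 : ℝ)..s, τ * ufun a1 a2 C1 C2 τ = Kfun a1 a2 C1 C2 s := by
  simp_rw [ufun_eq_div, ← mul_div_assoc]
  rw [intervalIntegral.integral_div,
    integral_mul_rpow_mul_ML (sub_pos.2 ha12) (div_pos hC2 hC1) ha1 hs, Kfun,
    show -C2 * s ^ (a1 - a2) / C1 = -(C2 / C1 * s ^ (a1 - a2)) by ring]
  ring

lemma integral_Ufun_sub_mul_ufun (ha1 : 0 < a1) (ha12 : a2 < a1) (hC1 : 0 < C1) (hC2 : 0 < C2)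
    {s : ℝ} (hs : 0 < s) :
    ∫ τ in (0 : ℝ)..s, Ufun a1 a2 C1 C2 (s - τ) * ufun a1 a2 C1 C2 τ
      = s ^ (2 * a1) / C1 ^ 2 * ML2 (a1 - a2) (2 * a1 + 1) (-C2 * s ^ (a1 - a2) / C1) := by
  have h := integral_convolution_rpow_mul_ML (sub_pos.2 ha12) (div_pos hC2 hC1) ha1
    (d := a1 + 1) (by positivity) hs
  rw [show a1 + (a1 + 1) - 1 = 2 * a1 by ring, show a1 + (a1 + 1) = 2 * a1 + 1 by ring,
    add_sub_cancel_right] at h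
  simp_rw [ufun_eq_div, Ufun_eq_div, div_mul_div_comm]
  rw [intervalIntegral.integral_div, h,
    show -C2 * s ^ (a1 - a2) / C1 = -(C2 / C1 * s ^ (a1 - a2)) by ring]
  ring

lemma CovN_sub_eq_integral (ha1 : 0 < a1) (ha12 : a2 < a1) (hC1 : 0 < C1) (hC2 : 0 < C2)
    (lam : ℝ) {s t : ℝ} (hs : 0 < s) (hst : s ≤ t) :
    CovN a1 a2 C1 C2 lam s t - lam * (Ufun a1 a2 C1 C2 s + lam * s ^ (2 * a1) / C1 ^ 2
        * ML2 (a1 - a2) (2 * a1 + 1) (-C2 * s ^ (a1 - a2) / C1))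
      = lam ^ 2 * ∫ τ in (0 : ℝ)..s,
          (Ufun a1 a2 C1 C2 (t - τ) - Ufun a1 a2 C1 C2 t) * ufun a1 a2 C1 C2 τ := by
  have hU : Continuous (Ufun a1 a2 C1 C2) := continuous_Ufun ha1 ha12
  have hu : IntervalIntegrable (ufun a1 a2 C1 C2) volume 0 s := intervalIntegrable_ufun ha1 ha12 0 s
  have hUu : ∀ r, IntervalIntegrable
      (fun τ => Ufun a1 a2 C1 C2 (r - τ) * ufun a1 a2 C1 C2 τ) volume 0 s := fun r =>
    hu.continuousOn_mul (hU.comp (continuous_const.sub continuous_id)).continuousOn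
  rw [CovN, CovY, min_eq_left hst]
  simp_rw [add_mul, sub_mul]
  rw [intervalIntegral.integral_add (hUu s) (hUu t),
    intervalIntegral.integral_sub (hUu t) (hu.const_mul _), intervalIntegral.integral_const_mul,
    integral_ufun ha1 ha12 hC1 hC2 hs, integral_Ufun_sub_mul_ufun ha1 ha12 hC1 hC2 hs]
  ring

end RenewalFunction

lemma exists_mem_Ioo_sub_eq_neg_mul {f f' : ℝ → ℝ} (hf : ∀ t, 0 < t → HasDerivAt f (f' t) t)
    {t τ : ℝ} (hτ : 0 < τ) (hτt : τ < t) :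
    ∃ ξ ∈ Set.Ioo (t - τ) t, f (t - τ) - f t = -(τ * f' ξ) := by
  have hpos : ∀ x ∈ Set.Icc (t - τ) t, 0 < x := fun x hx => (sub_pos.2 hτt).trans_le hx.1
  obtain ⟨ξ, hξ, h⟩ := exists_hasDerivAt_eq_slope f f' (sub_lt_self t hτ)
    (fun x hx => (hf x (hpos x hx)).continuousAt.continuousWithinAt)
    (fun x hx => hf x (hpos x (Set.Ioo_subset_Icc_self hx)))
  refine ⟨ξ, hξ, ?_⟩
  rw [h, sub_sub_cancel]
  field_simp
  ring

section RegularlyVarying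

variable {f f' : ℝ → ℝ} {r l : ℝ}

lemma tendsto_rpow_mul_shift_sub (hf : ∀ t, 0 < t → HasDerivAt f (f' t) t)
    (hlim : Tendsto (fun t => t ^ r * f' t) atTop (𝓝 l)) {τ : ℝ} (hτ : 0 < τ) :
    Tendsto (fun t => t ^ r * (f (t - τ) - f t)) atTop (𝓝 (-(τ * l))) := by
  have hex : ∀ t, ∃ ξ, τ < t → ξ ∈ Set.Ioo (t - τ) t ∧ f (t - τ) - f t = -(τ * f' ξ) := by
    intro t
    by_cases h : τ < t
    · obtain ⟨ξ, h1, h2⟩ := exists_mem_Ioo_sub_eq_neg_mul hf hτ h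
      exact ⟨ξ, fun _ => ⟨h1, h2⟩⟩
    · exact ⟨0, fun h' => absurd h' h⟩
  choose ξ hξ using hex
  have hξtop : Tendsto ξ atTop atTop := by
    refine tendsto_atTop_mono' _ ?_ (tendsto_atTop_add_const_right _ (-τ) tendsto_id)
    filter_upwards [eventually_gt_atTop τ] with t ht
    exact (hξ t ht).1.1.le
  have hratio : Tendsto (fun t => ξ t / t) atTop (𝓝 1) := by
    have h1 : Tendsto (fun t : ℝ => 1 - τ / t) atTop (𝓝 1) := by
      simpa using (tendsto_const_nhds (x := (1 : ℝ))).sub (tendsto_const_nhds.div_atTop tendsto_id)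
    refine tendsto_of_tendsto_of_tendsto_of_le_of_le' h1 tendsto_const_nhds ?_ ?_ <;>
      filter_upwards [eventually_gt_atTop τ] with t ht
    · have ht0 := hτ.trans ht
      rw [le_div_iff₀ ht0, sub_mul, div_mul_cancel₀ _ ht0.ne', one_mul]
      exact (hξ t ht).1.1.le
    · exact (div_le_one (hτ.trans ht)).2 (hξ t ht).1.2.le
  have hpow : Tendsto (fun t => (ξ t / t) ^ (-r)) atTop (𝓝 1) := by
    simpa using hratio.rpow_const (p := -r) (Or.inl one_ne_zero)
  have h := ((hpow.mul (hlim.comp hξtop)).const_mul τ).neg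
  rw [one_mul] at h
  refine h.congr' ?_
  filter_upwards [eventually_gt_atTop τ] with t ht
  have ht0 := hτ.trans ht
  have hξ0 : 0 < ξ t := (sub_pos.2 ht).trans (hξ t ht).1.1
  have hp := (rpow_pos_of_pos hξ0 r).ne'
  rw [(hξ t ht).2, div_rpow hξ0.le ht0.le, rpow_neg hξ0.le, rpow_neg ht0.le, Function.comp]
  field_simp

lemma eventually_norm_rpow_mul_shift_sub_le (hr : 0 ≤ r)
    (hf : ∀ t, 0 < t → HasDerivAt f (f' t) t)
    (hlim : Tendsto (fun t => t ^ r * f' t) atTop (𝓝 l)) {s : ℝ} (hs : 0 < s) :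
    ∀ᶠ t in atTop, ∀ τ ∈ Set.Ioc 0 s,
      ‖t ^ r * (f (t - τ) - f t)‖ ≤ 2 ^ r * (s * (|l| + 1)) := by
  obtain ⟨T, hT⟩ := eventually_atTop.1 (hlim.abs.eventually_le_const (lt_add_one |l|))
  filter_upwards [eventually_ge_atTop (2 * s), eventually_ge_atTop (T + s)] with t h2s hTs τ hτ
  obtain ⟨ξ, hξ, h⟩ := exists_mem_Ioo_sub_eq_neg_mul hf hτ.1 (show τ < t by linarith [hτ.2])
  have hξ0 : 0 < ξ := by linarith [hξ.1, hτ.2]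
  have ht : t ^ r ≤ 2 ^ r * ξ ^ r := by
    rw [← mul_rpow zero_le_two hξ0.le]
    exact rpow_le_rpow (by linarith) (by linarith [hξ.1, hτ.2]) hr
  have hb := hT ξ (by linarith [hξ.1, hτ.2])
  rw [abs_mul, abs_of_pos (rpow_pos_of_pos hξ0 r)] at hb
  have hτ0 := hτ.1
  rw [h, norm_mul, norm_neg, norm_mul, norm_of_nonneg (rpow_nonneg (by linarith) r),
    norm_of_nonneg hτ0.le, norm_eq_abs]
  calc t ^ r * (τ * |f' ξ|) ≤ 2 ^ r * ξ ^ r * (τ * |f' ξ|) := by gcongr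
    _ = 2 ^ r * (τ * (ξ ^ r * |f' ξ|)) := by ring
    _ ≤ _ := by gcongr; exact hτ.2

lemma tendsto_rpow_mul_integral_shift_sub_mul (hr : 0 ≤ r)
    (hcont : Continuous f) (hf : ∀ t, 0 < t → HasDerivAt f (f' t) t)
    (hlim : Tendsto (fun t => t ^ r * f' t) atTop (𝓝 l)) {g : ℝ → ℝ} {s : ℝ} (hs : 0 < s)
    (hg : IntervalIntegrable g volume 0 s) :
    Tendsto (fun t => t ^ r * ∫ τ in (0 : ℝ)..s, (f (t - τ) - f t) * g τ) atTop
      (𝓝 (-(l * ∫ τ in (0 : ℝ)..s, τ * g τ))) := by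
  have hint : ∀ t, IntervalIntegrable (fun τ => t ^ r * (f (t - τ) - f t) * g τ) volume 0 s :=
    fun t => hg.continuousOn_mul (by fun_prop)
  have h := intervalIntegral.tendsto_integral_filter_of_dominated_convergence
    (F := fun t τ => t ^ r * (f (t - τ) - f t) * g τ) (f := fun τ => -(τ * l) * g τ)
    (μ := volume) (a := 0) (b := s) (l := atTop)
    (fun τ => 2 ^ r * (s * (|l| + 1)) * ‖g τ‖)
    (Eventually.of_forall fun t => (hint t).def'.aestronglyMeasurable) ?_
    (hg.norm.const_mul _) ?_
  · simp_rw [mul_assoc, intervalIntegral.integral_const_mul] at h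
    convert h using 2
    rw [← intervalIntegral.integral_const_mul, ← intervalIntegral.integral_neg]
    congr 1
    ext τ
    ring
  · filter_upwards [eventually_norm_rpow_mul_shift_sub_le hr hf hlim hs] with t ht
    refine ae_of_all _ fun τ hτ => ?_
    rw [Set.uIoc_of_le hs.le] at hτ
    rw [norm_mul]
    exact mul_le_mul_of_nonneg_right (ht τ hτ) (norm_nonneg _)
  · refine ae_of_all _ fun τ hτ => ?_
    rw [Set.uIoc_of_le hs.le] at hτ
    exact (tendsto_rpow_mul_shift_sub hf hlim hτ.1).mul_const _

end RegularlyVarying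

/-- Proposition 4.1: with `L(s) = U(s) + (λ s^{2α₁}/C₁²) E²_{α₁-α₂,2α₁+1}(-C₂ s^{α₁-α₂}/C₁)`,
`t^{1-α₂}(Cov_N(s,t) - λL(s)) → -λ²K(s)` as `t → ∞`, i.e.
`Cov_N(s,t) = λL(s) - λ²K(s)t^{α₂-1} + o(t^{α₂-1})`. -/
theorem stmt_12 (a1 a2 C1 C2 : ℝ) (ha2 : 0 < a2) (ha12 : a2 < a1) (ha1 : a1 < 1)
    (hC1 : 0 < C1) (hC2 : 0 < C2) (hC : C1 + C2 = 1) (lam : ℝ) (hlam : 0 < lam)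
    (s : ℝ) (hs : 0 < s) :
    Tendsto (fun t : ℝ => t ^ (1 - a2) *
        (CovN a1 a2 C1 C2 lam s t
          - lam * (Ufun a1 a2 C1 C2 s
            + lam * s ^ (2 * a1) / C1 ^ 2
              * ML2 (a1 - a2) (2 * a1 + 1) (-C2 * s ^ (a1 - a2) / C1))))
      atTop (𝓝 (-(lam ^ 2 * Kfun a1 a2 C1 C2 s))) := by
  obtain ⟨U', hU', hlim⟩ := exists_hasDerivAt_Ufun_and_tendsto ha2 ha12 ha1 hC1 hC2
  have ha1pos := ha2.trans ha12
  have h := (tendsto_rpow_mul_integral_shift_sub_mul (sub_nonneg.2 (ha12.trans ha1).le)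
    (continuous_Ufun ha1pos ha12) hU' hlim hs
    (intervalIntegrable_ufun (C1 := C1) (C2 := C2) ha1pos ha12 0 s)).const_mul (lam ^ 2)
  rw [integral_mul_ufun ha1pos ha12 hC1 hC2 hs, mul_neg] at h
  refine h.congr' ?_
  filter_upwards [eventually_ge_atTop s] with t hst
  rw [CovN_sub_eq_integral ha1pos ha12 hC1 hC2 lam hs hst]
  ring
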